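/- arXiv:1109.3756 — 2 statements merged into one kernel-verified Lean document; each statement's English description precedes it below -/
import Mathlib

section
/- Let F = ℤ/2ℤ and let M be an F-vector space equipped with a direct sum decomposition M = ⊕_{k∈ℤ} M_k in which only finitely many of the M_k are nonzero. For s ∈ ℤ, let π_{≤s}, π_{≥s} : M → M denote the projections onto ⊕_{k≤s} M_k and ⊕_{k≥s} M_k respectively. Then the F-linear map G : ∏_{t∈ℤ} M → ∏_{t∈ℤ} M defined by G(x)_t = π_{≥t+1}(x_{t+1}) + x_t + π_{≤t−1}(x_{t−1}) is bijective. -/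
open DirectSum

namespace FramedFloerStmt7

/-- The base field `ℤ/2ℤ`. -/
abbrev F2 := ZMod 2

variable (V : ℤ → Type) [∀ k, AddCommGroup (V k)] [∀ k, Module F2 (V k)]

/-- The projection of `⨁ k, V k` onto the part in degrees `≤ s`. -/
def truncLE (s : ℤ) : (⨁ k, V k) →ₗ[F2] ⨁ k, V k :=
  DirectSum.toModule F2 ℤ _ fun k => if k ≤ s then DirectSum.lof F2 ℤ V k else 0

/-- The projection of `⨁ k, V k` onto the part in degrees `≥ s`. -/
def truncGE (s : ℤ) : (⨁ k, V k) →ₗ[F2] ⨁ k, V k :=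
  DirectSum.toModule F2 ℤ _ fun k => if s ≤ k then DirectSum.lof F2 ℤ V k else 0

/-- The map `G : ∏_{t ∈ ℤ} M → ∏_{t ∈ ℤ} M` given by
`G(x)_t = π_{≥ t+1}(x_{t+1}) + x_t + π_{≤ t-1}(x_{t-1})`. -/
def G : (ℤ → ⨁ k, V k) →ₗ[F2] (ℤ → ⨁ k, V k) :=
  LinearMap.pi fun t =>
    truncGE V (t + 1) ∘ₗ LinearMap.proj (t + 1)
      + (LinearMap.proj t : (ℤ → ⨁ k, V k) →ₗ[F2] ⨁ k, V k)
      + truncLE V (t - 1) ∘ₗ LinearMap.proj (t - 1)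

variable {V}

theorem truncLE_apply (s : ℤ) (x : ⨁ k, V k) (k : ℤ) :
    truncLE V s x k = if k ≤ s then x k else 0 := by
  induction x using DirectSum.induction_on with
  | zero => simp
  | of i v =>
    rw [← DirectSum.lof_eq_of F2, truncLE, DirectSum.toModule_lof, DirectSum.lof_eq_of]
    by_cases hik : i = k
    · subst hik
      split_ifs <;> simp [DirectSum.lof_eq_of]
    · split_ifs <;> simp [DirectSum.lof_eq_of, DirectSum.of_eq_of_ne _ _ _ (Ne.symm hik)]
  | add x y hx hy =>
    rw [map_add, DirectSum.add_apply, hx, hy, DirectSum.add_apply]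
    split_ifs <;> simp

theorem truncGE_apply (s : ℤ) (x : ⨁ k, V k) (k : ℤ) :
    truncGE V s x k = if s ≤ k then x k else 0 := by
  induction x using DirectSum.induction_on with
  | zero => simp
  | of i v =>
    rw [← DirectSum.lof_eq_of F2, truncGE, DirectSum.toModule_lof, DirectSum.lof_eq_of]
    by_cases hik : i = k
    · subst hik
      split_ifs <;> simp [DirectSum.lof_eq_of]
    · split_ifs <;> simp [DirectSum.lof_eq_of, DirectSum.of_eq_of_ne _ _ _ (Ne.symm hik)]
  | add x y hx hy =>
    rw [map_add, DirectSum.add_apply, hx, hy, DirectSum.add_apply]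
    split_ifs <;> simp

theorem G_apply (x : ℤ → ⨁ k, V k) (t k : ℤ) :
    G V x t k = (if t + 1 ≤ k then x (t + 1) k else 0) + x t k
      + (if k ≤ t - 1 then x (t - 1) k else 0) := by
  simp [G, truncLE_apply, truncGE_apply]

theorem G_apply_self (x : ℤ → ⨁ k, V k) (k : ℤ) : G V x k k = x k k := by
  simp [G_apply]

theorem G_apply_of_lt (x : ℤ → ⨁ k, V k) {t k : ℤ} (h : t < k) :
    G V x t k = x (t + 1) k + x t k := by
  rw [G_apply, if_pos (by omega), if_neg (by omega), add_zero]

theorem G_apply_of_gt (x : ℤ → ⨁ k, V k) {t k : ℤ} (h : k < t) :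
    G V x t k = x t k + x (t - 1) k := by
  rw [G_apply, if_neg (by omega), if_pos (by omega), zero_add]

theorem G_injective : Function.Injective (G V) := by
  rw [injective_iff_map_eq_zero]
  intro x hx
  have hG (t k : ℤ) : G V x t k = 0 := by simp [hx]
  funext t
  ext k
  rw [Pi.zero_apply, DirectSum.zero_apply]
  induction t using Int.inductionOn' (b := k) with
  | zero => rw [← G_apply_self, hG]
  | succ t ht ih =>
    have h := hG (t + 1) k
    rwa [G_apply_of_gt x (by omega), add_sub_cancel_right, ih, add_zero] at h
  | pred t ht ih =>
    have h := hG (t - 1) k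
    rwa [G_apply_of_lt x (by omega), sub_add_cancel, ih, zero_add] at h

/-- In degree `k`, the preimage of `y` at `t` is the sum of the `y u` over all `u` between
`t` and `k`. -/
theorem G_surjective (hfin : {k : ℤ | Nontrivial (V k)}.Finite) :
    Function.Surjective (G V) := by
  intro y
  let x : ℤ → ⨁ k, V k := fun t =>
    DirectSum.mk V hfin.toFinset fun k => ∑ u ∈ Finset.uIcc t k, y u k
  have hx (t k : ℤ) : x t k = ∑ u ∈ Finset.uIcc t k, y u k := by
    by_cases hk : k ∈ hfin.toFinset
    · exact DirectSum.mk_apply_of_mem hk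
    · have : Subsingleton (V k) := by simpa [not_nontrivial_iff_subsingleton] using hk
      exact Subsingleton.elim _ _
  refine ⟨x, ?_⟩
  funext t
  ext k
  rcases lt_trichotomy t k with h | rfl | h
  · rw [G_apply_of_lt x h, hx, hx, Finset.uIcc_of_le h, Finset.uIcc_of_le h.le,
      ← Finset.insert_Icc_add_one_left_eq_Icc h.le, Finset.sum_insert (by simp), add_left_comm,
      ZModModule.add_self, add_zero]
  · rw [G_apply_self, hx, Finset.uIcc_self, Finset.sum_singleton]
  · rw [G_apply_of_gt x h, hx, hx, Finset.uIcc_of_ge h.le, Finset.uIcc_of_ge (by omega),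
      ← Finset.insert_Icc_sub_one_right_eq_Icc h.le, Finset.sum_insert (by simp), add_assoc,
      ZModModule.add_self, add_zero]

variable (V)

/-- If `M = ⊕_{k ∈ ℤ} M_k` is a `ℤ/2ℤ`-vector space with only finitely
many nonzero graded pieces, then the map `G` on `∏_{t ∈ ℤ} M` defined by
`G(x)_t = π_{≥ t+1}(x_{t+1}) + x_t + π_{≤ t-1}(x_{t-1})` is bijective. -/
theorem g_bijective (hfin : {k : ℤ | Nontrivial (V k)}.Finite) :
    Function.Bijective (G V) :=
  ⟨G_injective, G_surjective hfin⟩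

end FramedFloerStmt7
end

section
/- Let F = ℤ/2ℤ. Suppose given: (1) a ℤ-graded F-vector space A_• with decompositions A_n = ⊕_{k∈ℤ} A_n^{(k)} for each n, with only finitely many nonzero summands in each degree n, and with degreewise projections π_{≤s}, π_{≥s} : A_n → A_n onto ⊕_{k≤s} A_n^{(k)} and ⊕_{k≥s} A_n^{(k)}; (2) for every s ∈ ℤ a degree −1 differential ∂_s making (A_•, ∂_s) a chain complex; (3) a chain complex (B_•, ∂_B) of F-vector spaces; (4) degree-zero chain maps Φ_s^+, Φ_s^− : (A_•, ∂_s) → (B_•, ∂_B) for every s ∈ ℤ. Assume: (i) for every s, π_{≤s} is a chain map from (A, ∂_s) to (A, ∂_{s+1}) and π_{≥s} is a chain map from (A, ∂_s) to (A, ∂_{s−1}); (ii) Φ_{s+1}^+ ∘ π_{≤s} = Φ_s^+ and Φ_{s−1}^− ∘ π_{≥s} = Φ_s^−; (iii) Φ_{s+1}^− ∘ π_{≤s} = 0 and Φ_{s−1}^+ ∘ π_{≥s} = 0. Define graded vector spaces X⁰ and X¹ by X^r_n = (∏_{s∈ℤ} A_n) ⊕ (∏_{s∈ℤ} B_{n+1}),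 with maps D⁰(a, b)_s = (∂_s a_s, Φ_s^+(a_s) + Φ_s^−(a_s) + ∂_B b_s) and D¹(a, b)_s = (∂_s a_s, Φ_s^+(a_s) + Φ_{s−1}^−(a_{s−1}) + ∂_B b_s). Then: D⁰ and D¹ square to zero, so X⁰ and X¹ are chain complexes; the maps f : B[1] → X⁰ given by f(b) = (0, (b)_{s∈ℤ}) (the constant sequence) and g : X⁰ → X¹ given by g(a, b)_t = (π_{≥t+1}(a_{t+1}) + a_t + π_{≤t−1}(a_{t−1}), b_t + b_{t−1}) are chain maps; and 0 → B[1] →^f X⁰ →^g X¹ → 0 is a short exact sequence of chain complexes (f is injective, g is surjective, and the kernel of g equals the image of f). -/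
open DirectSum

namespace FramedFloerStmt8

/-- The base field `ℤ/2ℤ`. -/
abbrev F2 := ZMod 2

variable (A : ℤ → ℤ → Type) [∀ n k, AddCommGroup (A n k)] [∀ n k, Module F2 (A n k)]
variable (B : ℤ → Type) [∀ n, AddCommGroup (B n)] [∀ n, Module F2 (B n)]

/-- The graded piece `A_n = ⊕_k A_n^{(k)}`. -/
abbrev GA (n : ℤ) : Type := ⨁ k, A n k

/-- Transport along an equality of degrees in the family `B`. -/
def bcast : ∀ {m n : ℤ}, m = n → (B m ≃ₗ[F2] B n)
  | _, _, rfl => LinearEquiv.refl _ _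

/-- The projection `π_{≤ s} : A_n → A_n` onto `⊕_{k ≤ s} A_n^{(k)}`. -/
def pile (n s : ℤ) : GA A n →ₗ[F2] GA A n :=
  DirectSum.toModule F2 ℤ _ fun k => if k ≤ s then DirectSum.lof F2 ℤ (A n) k else 0

/-- The projection `π_{≥ s} : A_n → A_n` onto `⊕_{k ≥ s} A_n^{(k)}`. -/
def pige (n s : ℤ) : GA A n →ₗ[F2] GA A n :=
  DirectSum.toModule F2 ℤ _ fun k => if s ≤ k then DirectSum.lof F2 ℤ (A n) k else 0

variable (dA : ∀ (s n : ℤ), GA A n →ₗ[F2] GA A (n - 1))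
variable (dB : ∀ n : ℤ, B n →ₗ[F2] B (n - 1))
variable (Phip Phim : ∀ (s n : ℤ), GA A n →ₗ[F2] B n)

/-- The underlying graded vector space `X_n = (∏_{s ∈ ℤ} A_n) × (∏_{s ∈ ℤ} B_{n+1})`
of both complexes `X⁰` and `X¹`. -/
abbrev Xsp (n : ℤ) : Type := ((s : ℤ) → GA A n) × ((s : ℤ) → B (n + 1))

/-- The differential `D⁰(a, b)_s = (∂_s a_s, Φ_s^+(a_s) + Φ_s^-(a_s) + ∂_B b_s)`. -/
def D0 (n : ℤ) : Xsp A B n →ₗ[F2] Xsp A B (n - 1) :=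
  LinearMap.prod
    (LinearMap.pi fun s => dA s n ∘ₗ LinearMap.proj s ∘ₗ LinearMap.fst F2 _ _)
    (LinearMap.pi fun s =>
      (bcast B (show n = n - 1 + 1 by ring)).toLinearMap ∘ₗ (Phip s n + Phim s n) ∘ₗ
          LinearMap.proj s ∘ₗ LinearMap.fst F2 _ _
        + (bcast B (show n + 1 - 1 = n - 1 + 1 by ring)).toLinearMap ∘ₗ dB (n + 1) ∘ₗ
          LinearMap.proj s ∘ₗ LinearMap.snd F2 _ _)

/-- The differential `D¹(a, b)_s = (∂_s a_s, Φ_s^+(a_s) + Φ_{s-1}^-(a_{s-1}) + ∂_B b_s)`. -/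
def D1 (n : ℤ) : Xsp A B n →ₗ[F2] Xsp A B (n - 1) :=
  LinearMap.prod
    (LinearMap.pi fun s => dA s n ∘ₗ LinearMap.proj s ∘ₗ LinearMap.fst F2 _ _)
    (LinearMap.pi fun s =>
      (bcast B (show n = n - 1 + 1 by ring)).toLinearMap ∘ₗ Phip s n ∘ₗ
          LinearMap.proj s ∘ₗ LinearMap.fst F2 _ _
        + (bcast B (show n = n - 1 + 1 by ring)).toLinearMap ∘ₗ Phim (s - 1) n ∘ₗ
          LinearMap.proj (s - 1) ∘ₗ LinearMap.fst F2 _ _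
        + (bcast B (show n + 1 - 1 = n - 1 + 1 by ring)).toLinearMap ∘ₗ dB (n + 1) ∘ₗ
          LinearMap.proj s ∘ₗ LinearMap.snd F2 _ _)

/-- The map `f : B[1] → X⁰`, `f(b) = (0, (b)_{s ∈ ℤ})` (the constant sequence). -/
def fmap (n : ℤ) : B (n + 1) →ₗ[F2] Xsp A B n :=
  LinearMap.prod 0 (LinearMap.pi fun _ => LinearMap.id)

/-- The map `g : X⁰ → X¹` given by
`g(a, b)_t = (π_{≥ t+1}(a_{t+1}) + a_t + π_{≤ t-1}(a_{t-1}), b_t + b_{t-1})`. -/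
def gmap (n : ℤ) : Xsp A B n →ₗ[F2] Xsp A B n :=
  LinearMap.prod
    (LinearMap.pi fun t =>
      pige A n (t + 1) ∘ₗ LinearMap.proj (t + 1) ∘ₗ
          LinearMap.fst F2 ((s : ℤ) → GA A n) ((s : ℤ) → B (n + 1))
        + LinearMap.proj t ∘ₗ LinearMap.fst F2 ((s : ℤ) → GA A n) ((s : ℤ) → B (n + 1))
        + pile A n (t - 1) ∘ₗ LinearMap.proj (t - 1) ∘ₗ
            LinearMap.fst F2 ((s : ℤ) → GA A n) ((s : ℤ) → B (n + 1)))
    (LinearMap.pi fun t =>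
      LinearMap.proj t ∘ₗ LinearMap.snd F2 ((s : ℤ) → GA A n) ((s : ℤ) → B (n + 1))
        + LinearMap.proj (t - 1) ∘ₗ
            LinearMap.snd F2 ((s : ℤ) → GA A n) ((s : ℤ) → B (n + 1)))

section Transport

variable {B}

lemma bcast_bcast {l m n : ℤ} (h : l = m) (h' : m = n) (x : B l) :
    bcast B h' (bcast B h x) = bcast B (h.trans h') x := by
  subst h h'
  rfl

lemma map_bcast {m n : ℤ} (h : m = n) (x : B m) :
    dB n (bcast B h x) = bcast B (congrArg (· - 1) h) (dB m x) := by
  subst h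
  rfl

end Transport

section Projections

variable {A}

lemma pile_apply (n s : ℤ) (x : GA A n) (k : ℤ) :
    pile A n s x k = if k ≤ s then x k else 0 := by
  induction x using DirectSum.induction_on with
  | zero => simp
  | of i y =>
    rw [← DirectSum.lof_eq_of F2, pile, DirectSum.toModule_lof]
    by_cases hik : i = k
    · subst hik
      split_ifs <;> simp
    · split_ifs <;> simp [DirectSum.lof_eq_of, DirectSum.of_eq_of_ne _ _ _ (Ne.symm hik)]
  | add x y hx hy =>
    rw [map_add, DirectSum.add_apply, hx, hy, DirectSum.add_apply]
    split_ifs <;> simp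

lemma pige_apply (n s : ℤ) (x : GA A n) (k : ℤ) :
    pige A n s x k = if s ≤ k then x k else 0 := by
  induction x using DirectSum.induction_on with
  | zero => simp
  | of i y =>
    rw [← DirectSum.lof_eq_of F2, pige, DirectSum.toModule_lof]
    by_cases hik : i = k
    · subst hik
      split_ifs <;> simp
    · split_ifs <;> simp [DirectSum.lof_eq_of, DirectSum.of_eq_of_ne _ _ _ (Ne.symm hik)]
  | add x y hx hy =>
    rw [map_add, DirectSum.add_apply, hx, hy, DirectSum.add_apply]
    split_ifs <;> simp

end Projections

lemma eq_zero_of_cone_eq_zero {M : Type*} [AddCommGroup M] (x : ℤ → M) (k : ℤ)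
    (h : ∀ t, (if t + 1 ≤ k then x (t + 1) else 0) + x t
      + (if k ≤ t - 1 then x (t - 1) else 0) = 0) (t : ℤ) : x t = 0 := by
  induction t using Int.inductionOn' (b := k) with
  | zero => simpa using h k
  | succ t ht ih => simpa [ih, show ¬ t + 1 + 1 ≤ k by omega] using h (t + 1)
  | pred t ht ih => simpa [ih, show ¬ k ≤ t - 1 - 1 by omega] using h (t - 1)

section Sequences

variable {M : Type*} [AddCommGroup M] [Module F2 M]

lemma add_self_eq_zero_of_F2 (x : M) : x + x = 0 := by
  rw [← two_smul F2 x, show (2 : F2) = 0 from rfl, zero_smul]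

lemma eq_of_add_eq_zero_of_F2 {x y : M} (h : x + y = 0) : x = y :=
  add_right_cancel (h.trans (add_self_eq_zero_of_F2 y).symm)

lemma sum_uIcc_add_sum_uIcc_sub_one (y : ℤ → M) {k t : ℤ} (h : k < t) :
    ∑ j ∈ Finset.uIcc k t, y j + ∑ j ∈ Finset.uIcc k (t - 1), y j = y t := by
  have hins : Finset.uIcc k t = insert t (Finset.uIcc k (t - 1)) := by
    ext j
    simp only [Finset.mem_uIcc, Finset.mem_insert]
    omega
  have hmem : t ∉ Finset.uIcc k (t - 1) := by
    simp only [Finset.mem_uIcc]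
    omega
  rw [hins, Finset.sum_insert hmem, add_assoc, add_self_eq_zero_of_F2, add_zero]

lemma sum_uIcc_add_one_add_sum_uIcc (y : ℤ → M) {k t : ℤ} (h : t < k) :
    ∑ j ∈ Finset.uIcc k (t + 1), y j + ∑ j ∈ Finset.uIcc k t, y j = y t := by
  have hins : Finset.uIcc k t = insert t (Finset.uIcc k (t + 1)) := by
    ext j
    simp only [Finset.mem_uIcc, Finset.mem_insert]
    omega
  have hmem : t ∉ Finset.uIcc k (t + 1) := by
    simp only [Finset.mem_uIcc]
    omega
  rw [hins, Finset.sum_insert hmem, add_left_comm, add_self_eq_zero_of_F2, add_zero]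

/-- The partial sums of `y` starting at `k` solve the equation defining the `k`-th summand
of `g`. -/
lemma cone_sum_uIcc (y : ℤ → M) (k t : ℤ) :
    (if t + 1 ≤ k then ∑ j ∈ Finset.uIcc k (t + 1), y j else 0) + ∑ j ∈ Finset.uIcc k t, y j
      + (if k ≤ t - 1 then ∑ j ∈ Finset.uIcc k (t - 1), y j else 0) = y t := by
  rcases lt_trichotomy t k with h | rfl | h
  · rw [if_pos (by omega), if_neg (by omega), add_zero, sum_uIcc_add_one_add_sum_uIcc y h]
  · simp
  · rw [if_neg (by omega), if_pos (by omega), zero_add, sum_uIcc_add_sum_uIcc_sub_one y h]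

lemma eq_apply_zero_of_add_sub_one_eq_zero (x : ℤ → M) (h : ∀ t, x t + x (t - 1) = 0)
    (t : ℤ) : x t = x 0 := by
  induction t using Int.induction_on with
  | zero => rfl
  | succ t ih =>
    rw [← ih]
    simpa using eq_of_add_eq_zero_of_F2 (h (t + 1))
  | pred t ih =>
    rw [← ih]
    exact (eq_of_add_eq_zero_of_F2 (h (-t))).symm

/-- Every sequence is of the form `x t + x (t - 1)`. -/
lemma exists_add_sub_one_eq (y : ℤ → M) : ∃ x : ℤ → M, ∀ t, x t + x (t - 1) = y t := by
  refine ⟨fun t => if 0 < t then ∑ j ∈ Finset.Ioc 0 t, y j else ∑ j ∈ Finset.Ioc t 0, y j,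
    fun t => ?_⟩
  rcases lt_or_ge 0 t with h | h
  · have hsum : ∑ j ∈ Finset.Ioc 0 t, y j = y t + ∑ j ∈ Finset.Ioc 0 (t - 1), y j := by
      rw [← Finset.sum_insert (by simp)]
      congr 1
      ext j
      simp only [Finset.mem_Ioc, Finset.mem_insert]
      omega
    rcases eq_or_ne t 1 with rfl | ht
    · simpa using hsum
    · simp only [if_pos h, if_pos (show 0 < t - 1 by omega)]
      rw [hsum, add_assoc, add_self_eq_zero_of_F2, add_zero]
  · have hsum : ∑ j ∈ Finset.Ioc (t - 1) 0, y j = y t + ∑ j ∈ Finset.Ioc t 0, y j := by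
      rw [← Finset.sum_insert (by simp)]
      congr 1
      ext j
      simp only [Finset.mem_Ioc, Finset.mem_insert]
      omega
    simp only [if_neg (show ¬ 0 < t by omega), if_neg (show ¬ 0 < t - 1 by omega)]
    rw [hsum, add_left_comm, add_self_eq_zero_of_F2, add_zero]

end Sequences

section Maps

variable {A B}

lemma gmap_fst (n : ℤ) (x : Xsp A B n) (t : ℤ) :
    (gmap A B n x).1 t =
      pige A n (t + 1) (x.1 (t + 1)) + x.1 t + pile A n (t - 1) (x.1 (t - 1)) :=
  rfl

lemma gmap_snd (n : ℤ) (x : Xsp A B n) (t : ℤ) :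
    (gmap A B n x).2 t = x.2 t + x.2 (t - 1) :=
  rfl

lemma gmap_fst_apply (n : ℤ) (x : Xsp A B n) (t k : ℤ) :
    (gmap A B n x).1 t k = (if t + 1 ≤ k then x.1 (t + 1) k else 0) + x.1 t k
      + (if k ≤ t - 1 then x.1 (t - 1) k else 0) := by
  rw [gmap_fst, DirectSum.add_apply, DirectSum.add_apply, pige_apply, pile_apply]

lemma gmap_surjective (n : ℤ) (hfin : {k : ℤ | Nontrivial (A n k)}.Finite) :
    Function.Surjective (gmap A B n) := by
  rintro ⟨y, z⟩
  obtain ⟨b, hb⟩ := exists_add_sub_one_eq z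
  let a : ℤ → GA A n := fun t =>
    DFinsupp.mk hfin.toFinset fun k => ∑ j ∈ Finset.uIcc (k : ℤ) t, y j k
  have ha (t k : ℤ) : a t k = ∑ j ∈ Finset.uIcc k t, y j k := by
    by_cases hk : Nontrivial (A n k)
    · exact DFinsupp.mk_of_mem (hfin.mem_toFinset.2 hk)
    · have := not_nontrivial_iff_subsingleton.1 hk
      exact Subsingleton.elim _ _
  refine ⟨(a, b), Prod.ext (funext fun t => DFinsupp.ext fun k => ?_) (funext hb)⟩
  refine (gmap_fst_apply n (a, b) t k).trans ?_
  simp only [ha]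
  exact cone_sum_uIcc (fun j => y j k) k t

lemma range_fmap_eq_ker_gmap (n : ℤ) :
    LinearMap.range (fmap A B n) = LinearMap.ker (gmap A B n) := by
  ext x
  rw [LinearMap.mem_range, LinearMap.mem_ker]
  constructor
  · rintro ⟨b, rfl⟩
    refine Prod.ext (funext fun t => DFinsupp.ext fun k => ?_) (funext fun t => ?_)
    · refine (gmap_fst_apply n _ t k).trans ?_
      simp [fmap]
    · exact add_self_eq_zero_of_F2 b
  · intro hx
    refine ⟨x.2 0, Prod.ext (funext fun t => DFinsupp.ext fun k => ?_) (funext fun t => ?_)⟩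
    · refine (eq_zero_of_cone_eq_zero (fun t => x.1 t k) k (fun t => ?_) t).symm
      rw [← gmap_fst_apply, hx]
      rfl
    · exact (eq_apply_zero_of_add_sub_one_eq_zero x.2
        (fun t => congrFun (congrArg Prod.snd hx) t) t).symm

lemma D0_snd_apply (n : ℤ) (x : Xsp A B n) (s : ℤ) :
    (D0 A B dA dB Phip Phim n x).2 s =
      bcast B (show n = n - 1 + 1 by ring) (Phip s n (x.1 s) + Phim s n (x.1 s))
        + bcast B (show n + 1 - 1 = n - 1 + 1 by ring) (dB (n + 1) (x.2 s)) :=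
  rfl

lemma D1_snd_apply (n : ℤ) (x : Xsp A B n) (s : ℤ) :
    (D1 A B dA dB Phip Phim n x).2 s =
      bcast B (show n = n - 1 + 1 by ring) (Phip s n (x.1 s))
        + bcast B (show n = n - 1 + 1 by ring) (Phim (s - 1) n (x.1 (s - 1)))
        + bcast B (show n + 1 - 1 = n - 1 + 1 by ring) (dB (n + 1) (x.2 s)) :=
  rfl

lemma D0_fst_apply (n : ℤ) (x : Xsp A B n) (s : ℤ) :
    (D0 A B dA dB Phip Phim n x).1 s = dA s n (x.1 s) :=
  rfl

lemma D1_fst_apply (n : ℤ) (x : Xsp A B n) (s : ℤ) :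
    (D1 A B dA dB Phip Phim n x).1 s = dA s n (x.1 s) :=
  rfl

end Maps

/-- The abstract short exact sequence
`0 → B[1] → X⁰ → X¹ → 0` underlying the surgery exact triangle:
`D⁰` and `D¹` square to zero, `f` and `g` are chain maps, `f` is injective, `g` is
surjective, and the kernel of `g` equals the image of `f`. -/
theorem surgery_short_exact_sequence
    (hfin : ∀ n : ℤ, {k : ℤ | Nontrivial (A n k)}.Finite)
    (hdA : ∀ (s n : ℤ) (x : GA A n), dA s (n - 1) (dA s n x) = 0)
    (hdB : ∀ (n : ℤ) (x : B n), dB (n - 1) (dB n x) = 0)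
    (hPhip : ∀ (s n : ℤ) (x : GA A n), dB n (Phip s n x) = Phip s (n - 1) (dA s n x))
    (hPhim : ∀ (s n : ℤ) (x : GA A n), dB n (Phim s n x) = Phim s (n - 1) (dA s n x))
    (hle : ∀ (s n : ℤ) (x : GA A n),
      dA (s + 1) n (pile A n s x) = pile A (n - 1) s (dA s n x))
    (hge : ∀ (s n : ℤ) (x : GA A n),
      dA (s - 1) n (pige A n s x) = pige A (n - 1) s (dA s n x))
    (hiip : ∀ (s n : ℤ) (x : GA A n), Phip (s + 1) n (pile A n s x) = Phip s n x)
    (hiim : ∀ (s n : ℤ) (x : GA A n), Phim (s - 1) n (pige A n s x) = Phim s n x)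
    (hiiim : ∀ (s n : ℤ) (x : GA A n), Phim (s + 1) n (pile A n s x) = 0)
    (hiiip : ∀ (s n : ℤ) (x : GA A n), Phip (s - 1) n (pige A n s x) = 0) :
    (∀ (n : ℤ) (x : Xsp A B n),
        D0 A B dA dB Phip Phim (n - 1) (D0 A B dA dB Phip Phim n x) = 0) ∧
    (∀ (n : ℤ) (x : Xsp A B n),
        D1 A B dA dB Phip Phim (n - 1) (D1 A B dA dB Phip Phim n x) = 0) ∧
    (∀ (n : ℤ) (b : B (n + 1)),
        D0 A B dA dB Phip Phim n (fmap A B n b) =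
          fmap A B (n - 1) (bcast B (show n + 1 - 1 = n - 1 + 1 by ring) (dB (n + 1) b))) ∧
    (∀ (n : ℤ) (x : Xsp A B n),
        D1 A B dA dB Phip Phim n (gmap A B n x) =
          gmap A B (n - 1) (D0 A B dA dB Phip Phim n x)) ∧
    (∀ n : ℤ, Function.Injective (fmap A B n)) ∧
    (∀ n : ℤ, Function.Surjective (gmap A B n)) ∧
    (∀ n : ℤ, LinearMap.range (fmap A B n) = LinearMap.ker (gmap A B n)) := by
  refine ⟨fun n x => Prod.ext (funext fun s => hdA s n _) (funext fun s => ?_),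
    fun n x => Prod.ext (funext fun s => hdA s n _) (funext fun s => ?_),
    fun n b => Prod.ext (funext fun s => map_zero (dA s n)) (funext fun s => ?_),
    fun n x => Prod.ext (funext fun t => ?_) (funext fun t => ?_),
    fun n b c h => congrFun (congrArg Prod.snd h) 0,
    fun n => gmap_surjective n (hfin n), range_fmap_eq_ker_gmap⟩
  · simp only [D0_snd_apply, D0_fst_apply, map_add, map_bcast, bcast_bcast, hdB, hPhip, hPhim,
      map_zero, add_zero]
    exact add_self_eq_zero_of_F2 _
  · simp only [D1_snd_apply, D1_fst_apply, map_add, map_bcast, bcast_bcast, hdB, hPhip, hPhim,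
      map_zero, add_zero]
    exact add_self_eq_zero_of_F2 _
  · rw [D0_snd_apply]
    simp [fmap]
  · have hge' := hge (t + 1) n (x.1 (t + 1))
    have hle' := hle (t - 1) n (x.1 (t - 1))
    rw [add_sub_cancel_right] at hge'
    rw [sub_add_cancel] at hle'
    simp only [D1_fst_apply, gmap_fst, D0_fst_apply, map_add, hge', hle']
  · have hp₁ := hiiip (t + 1) n (x.1 (t + 1))
    have hp₂ := hiip (t - 1) n (x.1 (t - 1))
    have hm₁ := hiim t n (x.1 t)
    have hm₂ := hiiim (t - 1 - 1) n (x.1 (t - 1 - 1))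
    rw [add_sub_cancel_right] at hp₁
    rw [sub_add_cancel] at hp₂ hm₂
    simp only [D1_snd_apply, gmap_fst, gmap_snd, D0_snd_apply, map_add, sub_add_cancel, hp₁, hp₂,
      hm₁, hm₂, map_zero]
    abel

end FramedFloerStmt8
end
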